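/- Let Z be a finite example domain, D a distribution on Z, m ∈ ℕ, and let A : Z^m → (probability distributions on a finite hypothesis set H) be a randomized algorithm. Let S ~ D^m and let h denote the output of A on S (so the conditional law of h given S is A(S)). Fix i ∈ [m]. For z ∈ Z, let S^{(i,z)} denote S with its i-th coordinate replaced by z, let Q_z denote the (marginal) distribution of A(S^{(i,z)}) when S ~ D^m, and let P denote the marginal distribution of h = A(S). Then √(I(h; S_i)) ≥ E_{z~D}[ d_TV(Q_z, P) ], where I is in bits and d_TV is the total variation distance. -/

import Mathlib

open scoped Classical

/-- Shannon entropy (in bits) of a distribution given by a weight function on a finite type. -/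
noncomputable def ent {α : Type*} [Fintype α] (p : α → ℝ) : ℝ :=
  - ∑ a, p a * Real.logb 2 (p a)

/-- Mutual information (in bits) between the two coordinates of a joint distribution
given by a weight function on a finite product type. -/
noncomputable def mutInfo {α β : Type*} [Fintype α] [Fintype β] (μ : α × β → ℝ) : ℝ :=
  ent (fun a => ∑ b, μ (a, b)) + ent (fun b => ∑ a, μ (a, b)) - ent μ

/-- Total variation distance between two distributions on a finite type. -/
noncomputable def dTV {α : Type*} [Fintype α] (p q : α → ℝ) : ℝ :=
  (1 / 2) * ∑ x, |p x - q x|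

section Pinsker

variable {α β : Type*} [Fintype α] [Fintype β]

/-- Pointwise lower bound on the relative entropy by the squared Hellinger distance. -/
theorem sq_sub_sqrt_add_le_mul_log {p q : ℝ} (hp : 0 ≤ p) (hq : 0 ≤ q) (h : q = 0 → p = 0) :
    (√p - √q) ^ 2 + (p - q) ≤ p * Real.log p - p * Real.log q := by
  rcases hp.eq_or_lt with rfl | hp
  · simp [Real.sq_sqrt hq]
  have hq : 0 < q := hq.lt_of_ne' fun h0 => hp.ne' (h h0)
  have hsp := Real.sqrt_pos.2 hp
  have hsq := Real.sqrt_pos.2 hq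
  have hlog := Real.log_le_sub_one_of_pos (div_pos hsq hsp)
  rw [Real.log_div hsq.ne' hsp.ne', Real.log_sqrt hq.le, Real.log_sqrt hp.le] at hlog
  have hmul := mul_le_mul_of_nonneg_left hlog hp.le
  have hdiv : p * (√q / √p - 1) = √p * √q - p := by
    rw [mul_sub, mul_one, mul_div_assoc', sub_left_inj, div_eq_iff hsp.ne']
    nlinarith [Real.sq_sqrt hp.le]
  rw [hdiv] at hmul
  nlinarith [Real.sq_sqrt hp.le, Real.sq_sqrt hq.le]

/-- Total variation is bounded by the Hellinger distance. -/
theorem sq_dTV_le_sum_sq_sub_sqrt {p q : α → ℝ} (hp : ∀ x, 0 ≤ p x) (hq : ∀ x, 0 ≤ q x)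
    (hp1 : ∑ x, p x = 1) (hq1 : ∑ x, q x = 1) :
    dTV p q ^ 2 ≤ ∑ x, (√(p x) - √(q x)) ^ 2 := by
  have hfactor : ∑ x, |p x - q x| = ∑ x, |√(p x) - √(q x)| * (√(p x) + √(q x)) := by
    refine Finset.sum_congr rfl fun x _ => ?_
    rw [← abs_of_nonneg (add_nonneg (Real.sqrt_nonneg (p x)) (Real.sqrt_nonneg (q x))), ← abs_mul]
    congr 1
    linear_combination - Real.sq_sqrt (hp x) + Real.sq_sqrt (hq x)
  have hcs := Finset.sum_mul_sq_le_sq_mul_sq Finset.univ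
    (fun x => |√(p x) - √(q x)|) (fun x => √(p x) + √(q x))
  simp only [sq_abs] at hcs
  have hsum : ∑ x, (√(p x) + √(q x)) ^ 2 ≤ 4 := by
    calc ∑ x, (√(p x) + √(q x)) ^ 2 ≤ ∑ x, (2 * p x + 2 * q x) := by
          refine Finset.sum_le_sum fun x _ => ?_
          nlinarith [Real.sq_sqrt (hp x), Real.sq_sqrt (hq x), sq_nonneg (√(p x) - √(q x))]
      _ = 4 := by
          rw [Finset.sum_add_distrib, ← Finset.mul_sum, ← Finset.mul_sum, hp1, hq1]
          norm_num
  have hnonneg : 0 ≤ ∑ x, (√(p x) - √(q x)) ^ 2 := Finset.sum_nonneg fun x _ => sq_nonneg _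
  rw [dTV, hfactor]
  nlinarith [mul_le_mul_of_nonneg_left hsum hnonneg]

/-- A weak form of Pinsker's inequality, with relative entropy in nats. -/
theorem sq_dTV_le_sum_mul_log {p q : α → ℝ} (hp : ∀ x, 0 ≤ p x) (hq : ∀ x, 0 ≤ q x)
    (hp1 : ∑ x, p x = 1) (hq1 : ∑ x, q x = 1) (hac : ∀ x, q x = 0 → p x = 0) :
    dTV p q ^ 2 ≤ ∑ x, (p x * Real.log (p x) - p x * Real.log (q x)) := by
  refine (sq_dTV_le_sum_sq_sub_sqrt hp hq hp1 hq1).trans ?_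
  have h := Finset.sum_le_sum fun x (_ : x ∈ Finset.univ) =>
    sq_sub_sqrt_add_le_mul_log (hp x) (hq x) (hac x)
  rw [Finset.sum_add_distrib, Finset.sum_sub_distrib p q, hp1, hq1] at h
  linarith

theorem ent_eq_div_log_two (p : α → ℝ) : ent p = -(∑ x, p x * Real.log (p x)) / Real.log 2 := by
  simp only [ent, Real.logb, neg_div, Finset.sum_div, mul_div_assoc]

/-- Mutual information is the relative entropy to the product of the marginals. -/
theorem mutInfo_eq_sum_mul_log {μ : α × β → ℝ} {a : α → ℝ} {b : β → ℝ}
    (ha : ∀ x, ∑ y, μ (x, y) = a x) (hb : ∀ y, ∑ x, μ (x, y) = b y)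
    (hac : ∀ w : α × β, a w.1 * b w.2 = 0 → μ w = 0) :
    mutInfo μ =
      (∑ w, (μ w * Real.log (μ w) - μ w * Real.log (a w.1 * b w.2))) / Real.log 2 := by
  have hlog : ∀ w : α × β, μ w * Real.log (a w.1 * b w.2) =
      μ w * Real.log (a w.1) + μ w * Real.log (b w.2) := by
    intro w
    by_cases hw : a w.1 * b w.2 = 0
    · simp [hac w hw]
    · rw [Real.log_mul (left_ne_zero_of_mul hw) (right_ne_zero_of_mul hw), mul_add]
  have hsa : ∑ w : α × β, μ w * Real.log (a w.1) = ∑ x, a x * Real.log (a x) := by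
    simp only [Fintype.sum_prod_type, ← Finset.sum_mul, ha]
  have hsb : ∑ w : α × β, μ w * Real.log (b w.2) = ∑ y, b y * Real.log (b y) := by
    simp only [Fintype.sum_prod_type_right, ← Finset.sum_mul, hb]
  simp only [mutInfo, ha, hb, ent_eq_div_log_two, hlog, Finset.sum_sub_distrib,
    Finset.sum_add_distrib, hsa, hsb]
  ring

/-- Total variation distance to the product of the marginals is at most the square root of
the mutual information. -/
theorem dTV_le_sqrt_mutInfo {μ : α × β → ℝ} {a : α → ℝ} {b : β → ℝ} (hμ : ∀ w, 0 ≤ μ w)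
    (ha : ∀ x, ∑ y, μ (x, y) = a x) (hb : ∀ y, ∑ x, μ (x, y) = b y) (ha1 : ∑ x, a x = 1) :
    dTV μ (fun w => a w.1 * b w.2) ≤ √(mutInfo μ) := by
  have ha0 : ∀ x, 0 ≤ a x := fun x => ha x ▸ Finset.sum_nonneg fun y _ => hμ _
  have hb0 : ∀ y, 0 ≤ b y := fun y => hb y ▸ Finset.sum_nonneg fun x _ => hμ _
  have hac : ∀ w : α × β, a w.1 * b w.2 = 0 → μ w = 0 := by
    rintro ⟨x, y⟩ hw
    rcases mul_eq_zero.1 hw with h | h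
    · exact (Finset.sum_eq_zero_iff_of_nonneg fun y _ => hμ _).1 ((ha x).trans h) y
        (Finset.mem_univ y)
    · exact (Finset.sum_eq_zero_iff_of_nonneg fun x _ => hμ _).1 ((hb y).trans h) x
        (Finset.mem_univ x)
  have hμ1 : ∑ w, μ w = 1 := by simp only [Fintype.sum_prod_type, ha, ha1]
  have hb1 : ∑ y, b y = 1 := by
    simp only [← hμ1, Fintype.sum_prod_type_right, hb]
  have hab1 : ∑ w : α × β, a w.1 * b w.2 = 1 := by
    simp only [Fintype.sum_prod_type, ← Finset.mul_sum, hb1, ha1, mul_one]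
  have hpinsker := sq_dTV_le_sum_mul_log hμ (fun w : α × β => mul_nonneg (ha0 w.1) (hb0 w.2))
    hμ1 hab1 hac
  refine Real.le_sqrt_of_sq_le (hpinsker.trans ?_)
  rw [mutInfo_eq_sum_mul_log ha hb hac]
  refine le_div_self ((sq_nonneg _).trans hpinsker) (Real.log_pos one_lt_two) ?_
  linarith [Real.log_two_lt_d9]

end Pinsker

section Resampling

variable {ι Z : Type*} [Fintype ι] [DecidableEq ι]

theorem mul_prod_eq_mul_prod_update (D : Z → ℝ) (i : ι) (z : Z) (s : ι → Z) :
    D z * ∏ j, D (s j) = D (s i) * ∏ j, D (Function.update s i z j) := by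
  rw [← Finset.mul_prod_erase _ _ (Finset.mem_univ i),
    ← Finset.mul_prod_erase _ (fun j => D (Function.update s i z j)) (Finset.mem_univ i),
    Finset.prod_congr rfl fun j hj => by
      rw [← Function.update_of_ne (Finset.ne_of_mem_erase hj) z s]]
  simp only [Function.update_self]
  ring

/-- Under a product distribution, replacing coordinate `i` by `z` amounts to conditioning on
the event that coordinate `i` equals `z`. -/
theorem mul_sum_prod_mul_update [Fintype Z] (D : Z → ℝ) (hD1 : ∑ z, D z = 1) (i : ι)
    (g : (ι → Z) → ℝ) (z : Z) :
    D z * ∑ s : ι → Z, (∏ j, D (s j)) * g (Function.update s i z) =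
      ∑ s ∈ Finset.univ.filter (fun s : ι → Z => s i = z), (∏ j, D (s j)) * g s := by
  have hswap : Function.Involutive
      (fun w : Z × (ι → Z) => (w.2 i, Function.update w.2 i w.1)) := by
    rintro ⟨w, s⟩
    simp
  calc D z * ∑ s : ι → Z, (∏ j, D (s j)) * g (Function.update s i z)
      = ∑ w : Z × (ι → Z), if w.1 = z then
          D w.1 * (∏ j, D (w.2 j)) * g (Function.update w.2 i w.1) else 0 := by
        rw [Fintype.sum_prod_type_right, Finset.mul_sum]
        simp [mul_assoc]
    _ = ∑ w : Z × (ι → Z), if w.2 i = z then D w.1 * (∏ j, D (w.2 j)) * g w.2 else 0 := by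
        rw [← Equiv.sum_comp hswap.toPerm]
        refine Finset.sum_congr rfl fun w _ => ?_
        simp [mul_prod_eq_mul_prod_update D i w.1 w.2]
    _ = _ := by
        rw [Fintype.sum_prod_type_right, Finset.sum_filter]
        refine Finset.sum_congr rfl fun s _ => ?_
        split_ifs
        · simp [mul_assoc, ← Finset.sum_mul, hD1]
        · simp

end Resampling

/-- For a randomized algorithm `A` on samples `S ~ D^m` with output `h`,
and a fixed coordinate `i`: `√(I(h; Sᵢ)) ≥ E_{z~D}[d_TV(Q_z, P)]`, where `Q_z` is the
marginal law of `A(S^{(i,z)})` and `P` is the marginal law of `A(S)`. -/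
theorem stmt17 {Z H : Type*} [Fintype Z] [Fintype H] (m : ℕ)
    (A : (Fin m → Z) → (H → ℝ)) (hA : ∀ s, (∀ f, 0 ≤ A s f) ∧ ∑ f, A s f = 1)
    (D : Z → ℝ) (hD0 : ∀ z, 0 ≤ D z) (hD1 : ∑ z, D z = 1)
    (i : Fin m) :
    ∑ z, D z * dTV
        (fun f => ∑ s : Fin m → Z, (∏ j, D (s j)) * A (Function.update s i z) f)
        (fun f => ∑ s : Fin m → Z, (∏ j, D (s j)) * A s f)
      ≤ Real.sqrt (mutInfo (fun p : Z × H =>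
          ∑ s ∈ Finset.univ.filter (fun s : Fin m → Z => s i = p.1),
            (∏ j, D (s j)) * A s p.2)) := by
  have hμ := fun z f => mul_sum_prod_mul_update D hD1 i (fun s => A s f) z
  set μ : Z × H → ℝ := fun p => ∑ s ∈ Finset.univ.filter (fun s : Fin m → Z => s i = p.1),
    (∏ j, D (s j)) * A s p.2 with hμ_def
  set P : H → ℝ := fun f => ∑ s : Fin m → Z, (∏ j, D (s j)) * A s f
  have hμ0 : ∀ w, 0 ≤ μ w := fun w => Finset.sum_nonneg fun s _ =>
    mul_nonneg (Finset.prod_nonneg fun j _ => hD0 _) ((hA s).1 _)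
  have hprod : ∑ s : Fin m → Z, ∏ j, D (s j) = 1 := by
    rw [← Fintype.prod_sum fun _ => D, hD1, Finset.prod_const_one]
  have ha : ∀ z, ∑ f, μ (z, f) = D z := by
    intro z
    simp only [hμ_def, ← hμ]
    rw [← Finset.mul_sum, Finset.sum_comm]
    simp only [← Finset.mul_sum, (hA _).2, mul_one, hprod]
  have hb : ∀ f, ∑ z, μ (z, f) = P f := fun f =>
    Finset.sum_fiberwise Finset.univ (fun s : Fin m → Z => s i) fun s => (∏ j, D (s j)) * A s f
  refine le_trans (le_of_eq ?_) (dTV_le_sqrt_mutInfo hμ0 ha hb hD1)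
  simp only [dTV, Fintype.sum_prod_type, Finset.mul_sum]
  refine Finset.sum_congr rfl fun z _ => Finset.sum_congr rfl fun f _ => ?_
  rw [show μ (z, f) = _ from (hμ z f).symm, ← mul_sub, abs_mul, abs_of_nonneg (hD0 z)]
  ring
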